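/- Let A be a real symmetric N×N Z-matrix with connectivity at most W_c ≥ 2, u a vector with all entries positive, and Ē > 0, with ρ = ρ_{A,u,Ē} and K_Ē as in the definitions, and assume the Separation Hypothesis with parameter S > 0, wells K_ℓ and neighborhoods Ω_ℓ. Fix δ > 0, define the counting functions N(λ) := #{eigenvalues λ_j of A with λ_j ≤ λ} (counted with multiplicity) and N₀(μ) := Σ_ℓ #{eigenvalues of the restricted matrix A|_{Ω_ℓ} on Ω_ℓ that are ≤ μ} (counted with multiplicity). Suppose μ ≤ Ē and N̄ ∈ ℕ satisfies (W_c²/δ³)·(max_{i,j∈[N]}|a_{ij}|)³·N̄ < e^{2S/√W_c}. Then min(N̄, N₀(μ − δ)) ≤ N(μ) and min(N̄, N(μ − δ)) ≤ N₀(μ). -/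

import Mathlib

open scoped ENNReal BigOperators
open Matrix

/-- The effective potential `(Au)_i / u_i`. -/
noncomputable def effV {N : ℕ} (A : Matrix (Fin N) (Fin N) ℝ) (u : Fin N → ℝ) (i : Fin N) : ℝ :=
  A.mulVec u i / u i

/-- The shifted effective potential `v_i = ((Au)_i/u_i - E)_+`. -/
noncomputable def shiftedV {N : ℕ} (A : Matrix (Fin N) (Fin N) ℝ) (u : Fin N → ℝ) (E : ℝ)
    (i : Fin N) : ℝ :=
  max (effV A u i - E) 0

/-- The weight of an edge `(i,j)`: `ln(1 + √(√(v_i v_j)/|a_ij|))`. -/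
noncomputable def edgeW {N : ℕ} (A : Matrix (Fin N) (Fin N) ℝ) (u : Fin N → ℝ) (E : ℝ)
    (i j : Fin N) : ℝ≥0∞ :=
  ENNReal.ofReal
    (Real.log (1 + Real.sqrt (Real.sqrt (shiftedV A u E i * shiftedV A u E j) / |A i j|)))

/-- The Agmon-type distance `ρ_{A,u,E}(i,j)`: infimum over paths `i = i_0, …, i_L = j` with
`a_{i_ℓ i_{ℓ+1}} ≠ 0` of the total edge weight; `∞` if there is no such path. -/
noncomputable def agmonDist {N : ℕ} (A : Matrix (Fin N) (Fin N) ℝ) (u : Fin N → ℝ) (E : ℝ)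
    (i j : Fin N) : ℝ≥0∞ :=
  ⨅ (L : ℕ) (p : Fin (L + 1) → Fin N) (_ : p 0 = i) (_ : p (Fin.last L) = j)
    (_ : ∀ ℓ : Fin L, A (p ℓ.castSucc) (p ℓ.succ) ≠ 0),
    ∑ ℓ : Fin L, edgeW A u E (p ℓ.castSucc) (p ℓ.succ)

/-- `ρ(i, M) = inf_{j ∈ M} ρ(i,j)` (`∞` when `M = ∅`). -/
noncomputable def agmonDistToSet {N : ℕ} (A : Matrix (Fin N) (Fin N) ℝ) (u : Fin N → ℝ) (E : ℝ)
    (i : Fin N) (M : Finset (Fin N)) : ℝ≥0∞ :=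
  ⨅ j ∈ M, agmonDist A u E i j

/-- The well set `K_E = {i : v_i = 0} = {i : (Au)_i/u_i ≤ E}`. -/
noncomputable def wellSet {N : ℕ} (A : Matrix (Fin N) (Fin N) ℝ) (u : Fin N → ℝ) (E : ℝ) :
    Finset (Fin N) :=
  Finset.univ.filter fun i => effV A u i ≤ E

/-- A `Z`-matrix: nonpositive off-diagonal entries. -/
def IsZMatrix {N : ℕ} (A : Matrix (Fin N) (Fin N) ℝ) : Prop :=
  ∀ i j, i ≠ j → A i j ≤ 0

/-- Connectivity at most `W`: every row and column has at most `W` nonzero off-diagonal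
entries. -/
def ConnAtMost {N : ℕ} (A : Matrix (Fin N) (Fin N) ℝ) (W : ℕ) : Prop :=
  ∀ i : Fin N, (Finset.univ.filter fun j => j ≠ i ∧ A i j ≠ 0).card ≤ W ∧
    (Finset.univ.filter fun j => j ≠ i ∧ A j i ≠ 0).card ≤ W

/-- `φ` is a local eigenvector of `A` on `M` with eigenvalue `E`: `φ ≠ 0`, `I_M φ = φ`, and
`I_M A I_M φ = E φ`. -/
def IsLocalEigenvector {N : ℕ} (A : Matrix (Fin N) (Fin N) ℝ) (M : Finset (Fin N)) (E : ℝ)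
    (φ : Fin N → ℝ) : Prop :=
  φ ≠ 0 ∧ (∀ i, i ∉ M → φ i = 0) ∧ (∀ i, i ∈ M → A.mulVec φ i = E * φ i)

/-- Extended exponential `e^x` for `x ∈ [0,∞]`. -/
noncomputable def eexp (x : ℝ≥0∞) : ℝ≥0∞ :=
  if x = ⊤ then ⊤ else ENNReal.ofReal (Real.exp x.toReal)

/-- The Separation Hypothesis (Hypothesis 5.1) for `A, u, Ē` with parameter `S`: the well set
`K_Ē` is partitioned into disjoint nonempty wells `K_ℓ` with pairwise disjoint neighborhoods
`Ω_ℓ ⊇ K_ℓ` such that `ρ(Ω_ℓᶜ, K_ℓ) ≥ S` and `ρ(∂⁻Ω_ℓ, K_ℓ) ≥ S`, where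
`∂⁻Ω_ℓ = {k ∈ Ω_ℓ : a_{kj} ≠ 0 for some j ∉ Ω_ℓ}`. -/
def SeparationHypothesis {N : ℕ} (A : Matrix (Fin N) (Fin N) ℝ) (u : Fin N → ℝ)
    (Ebar S : ℝ) {m : ℕ} (Kp Ω : Fin m → Finset (Fin N)) : Prop :=
  (∀ ℓ, (Kp ℓ).Nonempty) ∧
    (∀ ℓ ℓ', ℓ ≠ ℓ' → Disjoint (Kp ℓ) (Kp ℓ')) ∧
    (Finset.univ.biUnion Kp = wellSet A u Ebar) ∧
    (∀ ℓ, Kp ℓ ⊆ Ω ℓ) ∧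
    (∀ ℓ ℓ', ℓ ≠ ℓ' → Disjoint (Ω ℓ) (Ω ℓ')) ∧
    (∀ ℓ, ∀ i ∉ Ω ℓ, ENNReal.ofReal S ≤ agmonDistToSet A u Ebar i (Kp ℓ)) ∧
    (∀ ℓ, ∀ i ∈ Ω ℓ, (∃ j, j ∉ Ω ℓ ∧ A i j ≠ 0) →
      ENNReal.ofReal S ≤ agmonDistToSet A u Ebar i (Kp ℓ))

section QuadraticForms

variable {ι : Type*} [Fintype ι]

lemma dotProduct_mulVec_eq_sum (A : Matrix ι ι ℝ) (x : ι → ℝ) :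
    x ⬝ᵥ A *ᵥ x = ∑ i, ∑ j, A i j * (x i * x j) := by
  simp only [dotProduct, mulVec, Finset.mul_sum]
  exact Finset.sum_congr rfl fun i _ => Finset.sum_congr rfl fun j _ => by ring

/-- The ground state inequality for a symmetric matrix with nonpositive off-diagonal entries. -/
lemma sum_effective_potential_le {B : Matrix ι ι ℝ} (hB : B.IsSymm)
    (hZ : ∀ i j, i ≠ j → B i j ≤ 0) {u : ι → ℝ} (hu : ∀ i, 0 < u i) (f : ι → ℝ) :
    ∑ i, (B *ᵥ u) i / u i * f i ^ 2 ≤ f ⬝ᵥ B *ᵥ f := by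
  have h1 : ∑ i, (B *ᵥ u) i / u i * f i ^ 2 = ∑ i, ∑ j, B i j * (u j / u i * f i ^ 2) := by
    refine Finset.sum_congr rfl fun i _ => ?_
    simp only [mulVec, dotProduct, Finset.sum_div, Finset.sum_mul]
    exact Finset.sum_congr rfl fun j _ => by ring
  have h2 : ∑ i, ∑ j, B i j * (u j / u i * f i ^ 2)
      = ∑ i, ∑ j, B i j * (u i / u j * f j ^ 2) := by
    rw [Finset.sum_comm]
    exact Finset.sum_congr rfl fun i _ => Finset.sum_congr rfl fun j _ => by rw [hB.apply]
  have h3 : ∑ i, (B *ᵥ u) i / u i * f i ^ 2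
      = ∑ i, ∑ j, B i j * ((u j / u i * f i ^ 2 + u i / u j * f j ^ 2) / 2) := by
    have : ∑ i, (B *ᵥ u) i / u i * f i ^ 2
        = (∑ i, ∑ j, B i j * (u j / u i * f i ^ 2)
          + ∑ i, ∑ j, B i j * (u i / u j * f j ^ 2)) / 2 := by
      rw [← h2, ← h1]; ring
    rw [this, ← Finset.sum_add_distrib, Finset.sum_div]
    refine Finset.sum_congr rfl fun i _ => ?_
    rw [← Finset.sum_add_distrib, Finset.sum_div]
    exact Finset.sum_congr rfl fun j _ => by ring
  rw [h3, dotProduct_mulVec_eq_sum]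
  refine Finset.sum_le_sum fun i _ => Finset.sum_le_sum fun j _ => ?_
  rcases eq_or_ne i j with rfl | hij
  · rw [div_self (hu i).ne']
    exact le_of_eq (by ring)
  · refine mul_le_mul_of_nonpos_left ?_ (hZ i j hij)
    have hi := hu i
    have hj := hu j
    have : (u j / u i * f i ^ 2 + u i / u j * f j ^ 2) / 2 - f i * f j
        = (u j * f i - u i * f j) ^ 2 / (2 * u i * u j) := by
      field_simp
      ring
    have h0 : 0 ≤ (u j * f i - u i * f j) ^ 2 / (2 * u i * u j) := by positivity
    linarith

/-- The localization formula for an eigenvector. -/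
lemma localized_quadratic_form {B : Matrix ι ι ℝ} (hB : B.IsSymm) {E : ℝ} {φ : ι → ℝ}
    (hφ : B *ᵥ φ = E • φ) (g : ι → ℝ) :
    (g * φ) ⬝ᵥ B *ᵥ (g * φ)
      = E * ∑ i, g i ^ 2 * φ i ^ 2
        - (∑ i, ∑ j, B i j * (φ i * φ j) * (g i - g j) ^ 2) / 2 := by
  have h1 : ∑ i, ∑ j, B i j * (φ i * φ j) * g i ^ 2 = E * ∑ i, g i ^ 2 * φ i ^ 2 := by
    rw [Finset.mul_sum]
    refine Finset.sum_congr rfl fun i _ => ?_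
    have : ∑ j, B i j * φ j = E * φ i := by
      simpa [mulVec, dotProduct] using congrFun hφ i
    calc ∑ j, B i j * (φ i * φ j) * g i ^ 2 = (φ i * g i ^ 2) * ∑ j, B i j * φ j := by
          rw [Finset.mul_sum]
          exact Finset.sum_congr rfl fun j _ => by ring
      _ = _ := by rw [this]; ring
  have h2 : ∑ i, ∑ j, B i j * (φ i * φ j) * g j ^ 2
      = ∑ i, ∑ j, B i j * (φ i * φ j) * g i ^ 2 := by
    rw [Finset.sum_comm]
    exact Finset.sum_congr rfl fun i _ => Finset.sum_congr rfl fun j _ => by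
      rw [hB.apply, mul_comm (φ j)]
  have h3 : ∑ i, ∑ j, B i j * (φ i * φ j) * (g i - g j) ^ 2
      = ∑ i, ∑ j, B i j * (φ i * φ j) * g i ^ 2 + ∑ i, ∑ j, B i j * (φ i * φ j) * g j ^ 2
        - 2 * ∑ i, ∑ j, B i j * (g i * φ i * (g j * φ j)) := by
    simp only [Finset.mul_sum, ← Finset.sum_add_distrib, ← Finset.sum_sub_distrib]
    exact Finset.sum_congr rfl fun i _ => Finset.sum_congr rfl fun j _ => by ring
  rw [dotProduct_mulVec_eq_sum, h3, h2, h1]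
  simp only [Pi.mul_apply]
  ring

lemma sum_neighbors_le [DecidableEq ι] {B : Matrix ι ι ℝ} (hB : B.IsSymm) {W : ℕ}
    (hW : ∀ i, (Finset.univ.filter fun j => j ≠ i ∧ B i j ≠ 0).card ≤ W)
    {h : ι → ℝ} (h0 : ∀ i, 0 ≤ h i) :
    ∑ i, ∑ j, (if j ≠ i ∧ B i j ≠ 0 then (h i + h j) / 2 else 0) ≤ W * ∑ i, h i := by
  have h1 : ∑ i, ∑ j, (if j ≠ i ∧ B i j ≠ 0 then h i else 0) ≤ W * ∑ i, h i := by
    rw [Finset.mul_sum]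
    refine Finset.sum_le_sum fun i _ => ?_
    rw [← Finset.sum_filter, Finset.sum_const, nsmul_eq_mul]
    exact mul_le_mul_of_nonneg_right (by exact_mod_cast hW i) (h0 i)
  have h2 : ∑ i, ∑ j, (if j ≠ i ∧ B i j ≠ 0 then h j else 0)
      = ∑ i, ∑ j, (if j ≠ i ∧ B i j ≠ 0 then h i else 0) := by
    rw [Finset.sum_comm]
    refine Finset.sum_congr rfl fun i _ => Finset.sum_congr rfl fun j _ => ?_
    rw [hB.apply]
    simp only [ne_comm (a := i)]
  have h3 : ∑ i, ∑ j, (if j ≠ i ∧ B i j ≠ 0 then (h i + h j) / 2 else 0)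
      = (∑ i, ∑ j, (if j ≠ i ∧ B i j ≠ 0 then h i else 0)
        + ∑ i, ∑ j, (if j ≠ i ∧ B i j ≠ 0 then h j else 0)) / 2 := by
    simp only [← Finset.sum_add_distrib, Finset.sum_div]
    refine Finset.sum_congr rfl fun i _ => Finset.sum_congr rfl fun j _ => ?_
    split_ifs <;> ring
  rw [h3, h2]
  linarith

/-- Agmon's decay estimate for an eigenvector of a symmetric matrix with nonpositive off-diagonal
entries, with a weight `g` vanishing on the wells `K`. -/
lemma agmon_estimate [DecidableEq ι] {B : Matrix ι ι ℝ} (hB : B.IsSymm)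
    (hZ : ∀ i j, i ≠ j → B i j ≤ 0) {W : ℕ} (hW0 : 0 < W)
    (hW : ∀ i, (Finset.univ.filter fun j => j ≠ i ∧ B i j ≠ 0).card ≤ W)
    {u : ι → ℝ} (hu : ∀ i, 0 < u i) {M : ℝ} (hM : ∀ i j, |B i j| ≤ M)
    {K : Finset ι} {g v : ι → ℝ} {E₀ : ℝ} (hv : ∀ i, 0 ≤ v i)
    (hV : ∀ i ∉ K, E₀ + v i ≤ (B *ᵥ u) i / u i)
    (hgK : ∀ i ∈ K, g i = 0)
    (hgadj : ∀ i ∈ K, ∀ j ∉ K, B i j ≠ 0 → g j = 1)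
    (hg : ∀ i ∉ K, ∀ j ∉ K, i ≠ j → B i j ≠ 0 →
      |B i j| * (g i - g j) ^ 2 ≤ g i * g j * √(v i * v j) / W)
    {E δ : ℝ} (hE : E ≤ E₀ - δ) {φ : ι → ℝ} (hφ : B *ᵥ φ = E • φ) :
    δ * ∑ i, g i ^ 2 * φ i ^ 2 ≤ W * M / 2 * ∑ i, φ i ^ 2 := by
  have hWr : (0 : ℝ) < W := by exact_mod_cast hW0
  set h : ι → ℝ := fun i => v i * (g i ^ 2 * φ i ^ 2) / W + M * φ i ^ 2 with hdef
  have hvg : ∀ i, 0 ≤ v i * (g i ^ 2 * φ i ^ 2) / W := fun i => by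
    have := hv i
    positivity
  have hM0 : ∀ i : ι, 0 ≤ M := fun i => (abs_nonneg _).trans (hM i i)
  have h0 : ∀ i, 0 ≤ h i := fun i => add_nonneg (hvg i) (mul_nonneg (hM0 i) (sq_nonneg _))
  have hbd : ∀ i ∈ K, ∀ j ∉ K, B i j ≠ 0 →
      |B i j| * |φ i * φ j| * (g i - g j) ^ 2 ≤ (h i + h j) / 2 := by
    intro i hi j hj hij
    rw [hgK i hi, hgadj i hi j hj hij]
    have h1 : |B i j| * |φ i * φ j| ≤ M * |φ i * φ j| :=
      mul_le_mul_of_nonneg_right (hM i j) (abs_nonneg _)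
    have h2 : |φ i * φ j| ≤ (φ i ^ 2 + φ j ^ 2) / 2 := by
      rw [abs_le]
      constructor <;> nlinarith [sq_nonneg (φ i - φ j), sq_nonneg (φ i + φ j)]
    have h3 := mul_le_mul_of_nonneg_left h2 (hM0 i)
    have := hvg i
    have := hvg j
    simp only [hdef]
    linarith
  have hterm : ∀ i j, -(B i j * (φ i * φ j) * (g i - g j) ^ 2)
      ≤ if j ≠ i ∧ B i j ≠ 0 then (h i + h j) / 2 else 0 := by
    intro i j
    split_ifs with hij
    · obtain ⟨hne, hb⟩ := hij
      have habs : -(B i j * (φ i * φ j) * (g i - g j) ^ 2)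
          ≤ |B i j| * |φ i * φ j| * (g i - g j) ^ 2 := by
        rw [← abs_mul, ← neg_mul]
        exact mul_le_mul_of_nonneg_right (neg_le_abs _) (sq_nonneg _)
      refine habs.trans ?_
      by_cases hi : i ∈ K <;> by_cases hj : j ∈ K
      · rw [hgK i hi, hgK j hj]
        have := h0 i
        have := h0 j
        simp
        linarith
      · exact hbd i hi j hj hb
      · have := hbd j hj i hi (by rwa [hB.apply])
        rw [hB.apply, mul_comm (φ j)] at this
        nlinarith [this]
      · have h1 := mul_le_mul_of_nonneg_right (hg i hi j hj hne.symm hb) (abs_nonneg (φ i * φ j))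
        have h2 : g i * g j * √(v i * v j) * |φ i * φ j|
            ≤ (v i * (g i ^ 2 * φ i ^ 2) + v j * (g j ^ 2 * φ j ^ 2)) / 2 := by
          rw [Real.sqrt_mul (hv i), abs_mul]
          have e1 := Real.sq_sqrt (hv i)
          have e2 := Real.sq_sqrt (hv j)
          rw [← sq_abs (φ i), ← sq_abs (φ j)]
          nth_rewrite 2 [← e1]
          nth_rewrite 2 [← e2]
          nlinarith [sq_nonneg (√(v i) * (g i * |φ i|) - √(v j) * (g j * |φ j|))]
        have h3 := div_le_div_of_nonneg_right h2 hWr.le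
        have := mul_nonneg (hM0 i) (sq_nonneg (φ i))
        have := mul_nonneg (hM0 i) (sq_nonneg (φ j))
        have e3 : (v i * (g i ^ 2 * φ i ^ 2) + v j * (g j ^ 2 * φ j ^ 2)) / 2 / W
          = (v i * (g i ^ 2 * φ i ^ 2) / W + v j * (g j ^ 2 * φ j ^ 2) / W) / 2 := by ring
        have e4 : g i * g j * √(v i * v j) / W * |φ i * φ j|
          = g i * g j * √(v i * v j) * |φ i * φ j| / W := by ring
        simp only [hdef]
        linarith
    · rw [not_and_or, not_not, not_not] at hij
      rcases hij with rfl | hij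
      · simp
      · simp [hij]
  have hsum : -(∑ i, ∑ j, B i j * (φ i * φ j) * (g i - g j) ^ 2) ≤ W * ∑ i, h i := by
    refine le_trans ?_ (sum_neighbors_le hB hW h0)
    simp only [← Finset.sum_neg_distrib]
    exact Finset.sum_le_sum fun i _ => Finset.sum_le_sum fun j _ => hterm i j
  have hWh : (W : ℝ) * ∑ i, h i = ∑ i, v i * (g i ^ 2 * φ i ^ 2) + W * M * ∑ i, φ i ^ 2 := by
    simp only [hdef, Finset.mul_sum, ← Finset.sum_add_distrib]
    exact Finset.sum_congr rfl fun i _ => by field_simp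
  have hlow : ∑ i, (E + v i + δ) * (g i ^ 2 * φ i ^ 2)
      ≤ ∑ i, (B *ᵥ u) i / u i * (g * φ) i ^ 2 := by
    refine Finset.sum_le_sum fun i _ => ?_
    by_cases hi : i ∈ K
    · simp [hgK i hi]
    · rw [Pi.mul_apply, mul_pow]
      exact mul_le_mul_of_nonneg_right (by linarith [hV i hi]) (by positivity)
  have hsplit : ∑ i, (E + v i + δ) * (g i ^ 2 * φ i ^ 2)
      = E * ∑ i, g i ^ 2 * φ i ^ 2 + ∑ i, v i * (g i ^ 2 * φ i ^ 2)
        + δ * ∑ i, g i ^ 2 * φ i ^ 2 := by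
    simp only [Finset.mul_sum, ← Finset.sum_add_distrib]
    exact Finset.sum_congr rfl fun i _ => by ring
  have hvsum : 0 ≤ ∑ i, v i * (g i ^ 2 * φ i ^ 2) :=
    Finset.sum_nonneg fun i _ => mul_nonneg (hv i) (by positivity)
  have := sum_effective_potential_le hB hZ hu (g * φ)
  rw [localized_quadratic_form hB hφ] at this
  linarith

end QuadraticForms

section Eigenvectors

variable {ι : Type*} [Fintype ι] [DecidableEq ι]

lemma Matrix.IsHermitian.dotProduct_eigenvectorBasis {A : Matrix ι ι ℝ} (hA : A.IsHermitian)
    (i j : ι) : (hA.eigenvectorBasis i).ofLp ⬝ᵥ (hA.eigenvectorBasis j).ofLp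
      = if i = j then 1 else 0 := by
  have := orthonormal_iff_ite.mp hA.eigenvectorBasis.orthonormal i j
  rw [EuclideanSpace.inner_eq_star_dotProduct] at this
  rw [dotProduct_comm]
  simpa using this

lemma Matrix.IsHermitian.sum_dotProduct_mul_dotProduct {A : Matrix ι ι ℝ}
    (hA : A.IsHermitian) (x y : ι → ℝ) :
    ∑ j, ((hA.eigenvectorBasis j).ofLp ⬝ᵥ x) * ((hA.eigenvectorBasis j).ofLp ⬝ᵥ y)
      = x ⬝ᵥ y := by
  have := hA.eigenvectorBasis.sum_inner_mul_inner (WithLp.toLp 2 x) (WithLp.toLp 2 y)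
  simp only [EuclideanSpace.inner_eq_star_dotProduct, star_trivial] at this
  rw [dotProduct_comm x y, ← this]
  exact Finset.sum_congr rfl fun j _ => by rw [dotProduct_comm _ y]

lemma Matrix.IsHermitian.eigenvectorBasis_dotProduct_mulVec {A : Matrix ι ι ℝ}
    (hA : A.IsHermitian) (x : ι → ℝ) (j : ι) :
    (hA.eigenvectorBasis j).ofLp ⬝ᵥ A *ᵥ x
      = hA.eigenvalues j * ((hA.eigenvectorBasis j).ofLp ⬝ᵥ x) := by
  have hT : Aᵀ = A := by simpa using hA.eq
  rw [dotProduct_mulVec, ← mulVec_transpose, hT, hA.mulVec_eigenvectorBasis, smul_dotProduct,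
    smul_eq_mul]

/-- A vector orthogonal to all eigenvectors with eigenvalue at most `t` has energy at least `t`,
with equality only for the zero vector. -/
lemma Matrix.IsHermitian.lt_quadratic_form {A : Matrix ι ι ℝ} (hA : A.IsHermitian) {t : ℝ}
    {x : ι → ℝ} (hx : ∀ j, hA.eigenvalues j ≤ t → (hA.eigenvectorBasis j).ofLp ⬝ᵥ x = 0)
    (hx0 : x ≠ 0) : t * (x ⬝ᵥ x) < x ⬝ᵥ A *ᵥ x := by
  rw [← hA.sum_dotProduct_mul_dotProduct x (A *ᵥ x),
    ← hA.sum_dotProduct_mul_dotProduct x x, Finset.mul_sum]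
  simp only [hA.eigenvectorBasis_dotProduct_mulVec]
  have hle : ∀ j, t * ((hA.eigenvectorBasis j).ofLp ⬝ᵥ x * (hA.eigenvectorBasis j).ofLp ⬝ᵥ x)
      ≤ (hA.eigenvectorBasis j).ofLp ⬝ᵥ x
        * (hA.eigenvalues j * (hA.eigenvectorBasis j).ofLp ⬝ᵥ x) := by
    intro j
    rcases le_or_gt (hA.eigenvalues j) t with h | h
    · simp [hx j h]
    · nlinarith [mul_self_nonneg ((hA.eigenvectorBasis j).ofLp ⬝ᵥ x)]
  obtain ⟨j, hj⟩ : ∃ j, (hA.eigenvectorBasis j).ofLp ⬝ᵥ x ≠ 0 := by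
    by_contra! h
    have := hA.sum_dotProduct_mul_dotProduct x x
    simp only [h, mul_zero, Finset.sum_const_zero] at this
    exact hx0 (dotProduct_self_eq_zero.mp this.symm)
  refine Finset.sum_lt_sum (fun j _ => hle j) ⟨j, Finset.mem_univ _, ?_⟩
  have ht : t < hA.eigenvalues j := by
    by_contra! h
    exact hj (hx j h)
  nlinarith [mul_self_pos.mpr hj]

lemma Matrix.IsHermitian.le_quadratic_form {A : Matrix ι ι ℝ} (hA : A.IsHermitian) {t : ℝ}
    {x : ι → ℝ} (hx : ∀ j, hA.eigenvalues j ≤ t → (hA.eigenvectorBasis j).ofLp ⬝ᵥ x = 0) :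
    t * (x ⬝ᵥ x) ≤ x ⬝ᵥ A *ᵥ x := by
  rcases eq_or_ne x 0 with rfl | h
  · simp
  · exact (hA.lt_quadratic_form hx h).le

end Eigenvectors

section OrthonormalFamilies

variable {ι κ J : Type*} [Fintype ι] [Fintype κ] [DecidableEq κ] [Fintype J]

lemma dotProduct_sum_smul_of_orthonormal {φ : κ → ι → ℝ}
    (hφ : ∀ k l, φ k ⬝ᵥ φ l = if k = l then 1 else 0) (c d : κ → ℝ) :
    (∑ k, c k • φ k) ⬝ᵥ (∑ k, d k • φ k) = ∑ k, c k * d k := by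
  simp [sum_dotProduct, dotProduct_sum, hφ, mul_comm]

/-- A family of `card κ` orthonormal vectors has a nontrivial combination orthogonal to fewer than
`card κ` given vectors. -/
lemma exists_combination_orthogonal {φ : κ → ι → ℝ}
    (hφ : ∀ k l, φ k ⬝ᵥ φ l = if k = l then 1 else 0)
    (e : J → ι → ℝ) (hcard : Fintype.card J < Fintype.card κ) :
    ∃ c : κ → ℝ, (∑ k, c k • φ k) ≠ 0 ∧ ∀ j, e j ⬝ᵥ (∑ k, c k • φ k) = 0 := by
  let F : (κ → ℝ) →ₗ[ℝ] (J → ℝ) := Matrix.mulVecLin (Matrix.of fun j k => e j ⬝ᵥ φ k)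
  have hF : LinearMap.ker F ≠ ⊥ := F.ker_ne_bot_of_finrank_lt (by simpa using hcard)
  obtain ⟨c, hc, hc0⟩ := Submodule.exists_mem_ne_zero_of_ne_bot hF
  refine ⟨c, fun h => hc0 ?_, fun j => ?_⟩
  · have h1 := dotProduct_sum_smul_of_orthonormal hφ c c
    rw [h, dotProduct_zero] at h1
    exact dotProduct_self_eq_zero.mp h1.symm
  · have h1 : F c j = 0 := by rw [LinearMap.mem_ker.mp hc]; rfl
    rw [← h1]
    simp [F, mulVec, dotProduct_sum, dotProduct_comm]
    simp [dotProduct]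

/-- Energy of a combination of low-lying eigenvectors of `B` that are small on `T`, for a matrix
`A` that differs from `B` only on `T`. -/
lemma quadratic_form_combination_le {A B : Matrix ι ι ℝ} {T : Finset ι} {M δ μ ε : ℝ}
    (hM : 0 ≤ M)
    (hAB : ∀ x : ι → ℝ, x ⬝ᵥ A *ᵥ x ≤ x ⬝ᵥ B *ᵥ x + M * ∑ i ∈ T, x i ^ 2)
    {φ : κ → ι → ℝ} (hφ : ∀ k l, φ k ⬝ᵥ φ l = if k = l then 1 else 0)
    {lam : κ → ℝ} (heig : ∀ k, B *ᵥ φ k = lam k • φ k) (hlam : ∀ k, lam k ≤ μ - δ)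
    (hT : ∀ k, ∑ i ∈ T, φ k i ^ 2 ≤ ε)
    (hsmall : M ≤ δ ∨ M * (Fintype.card κ * ε) ≤ δ) (c : κ → ℝ) :
    (∑ k, c k • φ k) ⬝ᵥ A *ᵥ (∑ k, c k • φ k)
      ≤ μ * ((∑ k, c k • φ k) ⬝ᵥ (∑ k, c k • φ k)) := by
  set ψ : ι → ℝ := ∑ k, c k • φ k with hψ
  have hnorm : ψ ⬝ᵥ ψ = ∑ k, c k ^ 2 := by
    rw [hψ, dotProduct_sum_smul_of_orthonormal hφ]
    simp [sq]
  have hc0 : 0 ≤ ∑ k, c k ^ 2 := Finset.sum_nonneg fun k _ => sq_nonneg _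
  have hBψ : B *ᵥ ψ = ∑ k, (c k * lam k) • φ k := by
    simp [hψ, mulVec_sum, mulVec_smul, heig, smul_smul]
  have hBq : ψ ⬝ᵥ B *ᵥ ψ ≤ (μ - δ) * ∑ k, c k ^ 2 := by
    rw [hBψ, hψ, dotProduct_sum_smul_of_orthonormal hφ, Finset.mul_sum]
    exact Finset.sum_le_sum fun k _ => by nlinarith [hlam k, sq_nonneg (c k)]
  have hT1 : ∑ i ∈ T, ψ i ^ 2 ≤ ∑ k, c k ^ 2 := by
    rw [← hnorm, dotProduct]
    simp only [sq]
    exact Finset.sum_le_univ_sum_of_nonneg fun i => mul_self_nonneg _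
  have hT2 : ∑ i ∈ T, ψ i ^ 2 ≤ (∑ k, c k ^ 2) * (Fintype.card κ * ε) := by
    calc ∑ i ∈ T, ψ i ^ 2
        ≤ ∑ i ∈ T, (∑ k, c k ^ 2) * ∑ k, φ k i ^ 2 := by
          refine Finset.sum_le_sum fun i _ => ?_
          simp only [hψ, Finset.sum_apply, Pi.smul_apply, smul_eq_mul]
          exact Finset.sum_mul_sq_le_sq_mul_sq _ _ _
      _ = (∑ k, c k ^ 2) * ∑ k, ∑ i ∈ T, φ k i ^ 2 := by
          rw [← Finset.mul_sum, Finset.sum_comm]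
      _ ≤ _ := by
          refine mul_le_mul_of_nonneg_left ?_ hc0
          simpa using Finset.sum_le_sum fun k (_ : k ∈ Finset.univ) => hT k
  have hMT : M * ∑ i ∈ T, ψ i ^ 2 ≤ δ * ∑ k, c k ^ 2 := by
    rcases hsmall with h | h
    · exact (mul_le_mul_of_nonneg_left hT1 hM).trans (mul_le_mul_of_nonneg_right h hc0)
    · have h1 := mul_le_mul_of_nonneg_left hT2 hM
      have h2 := mul_le_mul_of_nonneg_right h hc0
      linarith
  rw [hnorm]
  linarith [hAB ψ]

end OrthonormalFamilies

section AgmonDistance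

variable {N : ℕ} {A : Matrix (Fin N) (Fin N) ℝ} {u : Fin N → ℝ} {E : ℝ}

lemma shiftedV_nonneg (i : Fin N) : 0 ≤ shiftedV A u E i := le_max_right _ _

lemma agmonDist_self (i : Fin N) : agmonDist A u E i i = 0 := by
  refine le_antisymm ?_ zero_le
  exact (iInf_le_of_le 0 <| iInf_le_of_le (fun _ => i) <| iInf_le_of_le rfl <|
    iInf_le_of_le rfl <| iInf_le_of_le (fun l => l.elim0) (by simp))

lemma agmonDist_le_edge_add {i j : Fin N} (hij : A i j ≠ 0) (k : Fin N) :
    agmonDist A u E i k ≤ edgeW A u E i j + agmonDist A u E j k := by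
  conv_rhs => rw [agmonDist]
  simp only [ENNReal.add_iInf]
  refine le_iInf fun L => le_iInf fun p => le_iInf fun h0 => le_iInf fun hL => le_iInf fun hp => ?_
  refine iInf_le_of_le (L + 1) <| iInf_le_of_le (Fin.cons i p) <| iInf_le_of_le rfl <|
    iInf_le_of_le ?_ <| iInf_le_of_le ?_ ?_
  · rw [← Fin.succ_last, Fin.cons_succ, hL]
  · intro l
    refine Fin.cases ?_ (fun l => ?_) l
    · simpa [h0] using hij
    · rw [← Fin.succ_castSucc, Fin.cons_succ, Fin.cons_succ]
      exact hp l
  · rw [Fin.sum_univ_succ]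
    simp [h0]

lemma agmonDistToSet_le_edge_add {i j : Fin N} (hij : A i j ≠ 0) (K : Finset (Fin N)) :
    agmonDistToSet A u E i K ≤ edgeW A u E i j + agmonDistToSet A u E j K := by
  conv_rhs => rw [agmonDistToSet]
  simp only [ENNReal.add_iInf]
  exact le_iInf fun k => le_iInf fun hk =>
    (iInf₂_le k hk).trans (agmonDist_le_edge_add hij k)

lemma agmonDistToSet_of_mem {i : Fin N} {K : Finset (Fin N)} (hi : i ∈ K) :
    agmonDistToSet A u E i K = 0 :=
  le_antisymm ((iInf₂_le i hi).trans (agmonDist_self i).le) zero_le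

/-- The Agmon distance to `K` truncated at `S`. -/
noncomputable def truncatedDist (A : Matrix (Fin N) (Fin N) ℝ) (u : Fin N → ℝ) (E S : ℝ)
    (K : Finset (Fin N)) (i : Fin N) : ℝ :=
  (min (agmonDistToSet A u E i K) (ENNReal.ofReal S)).toReal

variable {S : ℝ} {K : Finset (Fin N)}

lemma truncatedDist_of_le {i : Fin N} (hS : 0 ≤ S)
    (hi : ENNReal.ofReal S ≤ agmonDistToSet A u E i K) : truncatedDist A u E S K i = S := by
  rw [truncatedDist, min_eq_right hi, ENNReal.toReal_ofReal hS]

lemma truncatedDist_le_add {i j : Fin N} (hij : A i j ≠ 0) :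
    truncatedDist A u E S K i
      ≤ Real.log (1 + √(√(shiftedV A u E i * shiftedV A u E j) / |A i j|))
        + truncatedDist A u E S K j := by
  set d := Real.log (1 + √(√(shiftedV A u E i * shiftedV A u E j) / |A i j|))
  have hd0 : 0 ≤ d := Real.log_nonneg (le_add_of_nonneg_right (Real.sqrt_nonneg _))
  have hW : edgeW A u E i j = ENNReal.ofReal d := rfl
  have h := agmonDistToSet_le_edge_add (u := u) (E := E) hij K
  rw [hW] at h
  have hne : ∀ k, min (agmonDistToSet A u E k K) (ENNReal.ofReal S) ≠ ⊤ := fun k =>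
    ne_top_of_le_ne_top ENNReal.ofReal_ne_top (min_le_right _ _)
  have h2 : min (agmonDistToSet A u E i K) (ENNReal.ofReal S)
      ≤ ENNReal.ofReal d + min (agmonDistToSet A u E j K) (ENNReal.ofReal S) := by
    rw [← min_add_add_left]
    exact min_le_min h le_add_self
  have h3 := ENNReal.toReal_mono (ENNReal.add_ne_top.mpr ⟨ENNReal.ofReal_ne_top, hne j⟩) h2
  rwa [ENNReal.toReal_add ENNReal.ofReal_ne_top (hne j), ENNReal.toReal_ofReal hd0] at h3

lemma truncatedDist_adjacent {i j : Fin N} (hi : i ∈ K) (hij : A j i ≠ 0)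
    (hv : shiftedV A u E i = 0) : truncatedDist A u E S K j = 0 := by
  have h := truncatedDist_le_add (u := u) (E := E) (S := S) (K := K) hij
  have h0 : truncatedDist A u E S K i = 0 := by
    rw [truncatedDist, agmonDistToSet_of_mem hi]
    simp
  rw [h0, hv] at h
  simp at h
  exact le_antisymm h ENNReal.toReal_nonneg

/-- Bernoulli's inequality for exponential weights with exponent `α ≤ 1`. -/
lemma sq_exp_sub_exp_le_of_le {α r s x : ℝ} (hα0 : 0 ≤ α) (hα1 : α ≤ 1) (hx : 0 ≤ x)
    (hsr : s ≤ r) (hrs : r ≤ Real.log (1 + x) + s) :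
    (Real.exp (α * r) - Real.exp (α * s)) ^ 2
      ≤ Real.exp (α * r) * Real.exp (α * s) * (α ^ 2 * x ^ 2) := by
  have h1 : Real.exp (α * (r - s)) ≤ 1 + α * x := by
    calc Real.exp (α * (r - s)) ≤ Real.exp (Real.log (1 + x) * α) :=
          Real.exp_le_exp.mpr (by nlinarith)
      _ = (1 + x) ^ α := (Real.rpow_def_of_pos (by linarith) _).symm
      _ ≤ 1 + α * x := rpow_one_add_le_one_add_mul_self (by linarith) hα0 hα1
  have h2 : 1 ≤ Real.exp (α * (r - s)) :=
    Real.one_le_exp (mul_nonneg hα0 (sub_nonneg.mpr hsr))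
  have h3 : Real.exp (α * r) = Real.exp (α * s) * Real.exp (α * (r - s)) := by
    rw [← Real.exp_add]; ring_nf
  rw [h3]
  set y := Real.exp (α * (r - s))
  have h4 : (y - 1) ^ 2 ≤ y * (α ^ 2 * x ^ 2) := by
    have h5 : (y - 1) ^ 2 ≤ (α * x) ^ 2 := pow_le_pow_left₀ (by linarith) (by linarith) 2
    have h6 : 0 ≤ (α * x) ^ 2 := sq_nonneg _
    nlinarith
  nlinarith [mul_le_mul_of_nonneg_left h4 (sq_nonneg (Real.exp (α * s)))]

lemma sq_exp_sub_exp_le {α r s x : ℝ} (hα0 : 0 ≤ α) (hα1 : α ≤ 1) (hx : 0 ≤ x)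
    (hsr : s ≤ Real.log (1 + x) + r) (hrs : r ≤ Real.log (1 + x) + s) :
    (Real.exp (α * r) - Real.exp (α * s)) ^ 2
      ≤ Real.exp (α * r) * Real.exp (α * s) * (α ^ 2 * x ^ 2) := by
  rcases le_total s r with h | h
  · exact sq_exp_sub_exp_le_of_le hα0 hα1 hx h hrs
  · have := sq_exp_sub_exp_le_of_le hα0 hα1 hx h hsr
    nlinarith

/-- The exponential weight, set to zero on `K`. -/
noncomputable def agmonWeight (A : Matrix (Fin N) (Fin N) ℝ) (u : Fin N → ℝ) (E S α : ℝ)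
    (K : Finset (Fin N)) (i : Fin N) : ℝ :=
  if i ∈ K then 0 else Real.exp (α * truncatedDist A u E S K i)

lemma agmonWeight_edge (hA : A.IsSymm) {W : ℕ} (hW : 0 < W) {i j : Fin N} (hi : i ∉ K)
    (hj : j ∉ K) (hij : A i j ≠ 0) :
    |A i j| * (agmonWeight A u E S (1 / √W) K i - agmonWeight A u E S (1 / √W) K j) ^ 2
      ≤ agmonWeight A u E S (1 / √W) K i * agmonWeight A u E S (1 / √W) K j
        * √(shiftedV A u E i * shiftedV A u E j) / W := by
  have hWr : (1 : ℝ) ≤ W := by exact_mod_cast hW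
  have hsW : 1 ≤ √(W : ℝ) := Real.one_le_sqrt.mpr hWr
  simp only [agmonWeight, if_neg hi, if_neg hj]
  have h1 := truncatedDist_le_add (u := u) (E := E) (S := S) (K := K) hij
  have h2 := truncatedDist_le_add (u := u) (E := E) (S := S) (K := K)
    ((hA.apply i j).trans_ne hij)
  rw [hA.apply i j, mul_comm (shiftedV A u E j)] at h2
  set v := √(shiftedV A u E i * shiftedV A u E j)
  have h3 := sq_exp_sub_exp_le (α := 1 / √(W : ℝ)) (by positivity)
    (by rw [div_le_one (by linarith)]; exact hsW) (Real.sqrt_nonneg _) h2 h1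
  have hv : 0 ≤ v / |A i j| := by positivity
  rw [Real.sq_sqrt hv, div_pow, Real.sq_sqrt (by linarith), one_pow] at h3
  have h4 := mul_le_mul_of_nonneg_left h3 (abs_nonneg (A i j))
  refine h4.trans (le_of_eq ?_)
  have : |A i j| ≠ 0 := abs_ne_zero.mpr hij
  field_simp

end AgmonDistance

section Decoupling

variable {N : ℕ} {A : Matrix (Fin N) (Fin N) ℝ}

lemma abs_le_iSup_iSup_abs (A : Matrix (Fin N) (Fin N) ℝ) (i j : Fin N) :
    |A i j| ≤ ⨆ i : Fin N, ⨆ j : Fin N, |A i j| :=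
  (le_ciSup (f := fun j => |A i j|) (Set.finite_range _).bddAbove j).trans
    (le_ciSup (f := fun i => ⨆ j : Fin N, |A i j|) (Set.finite_range _).bddAbove i)

/-- The points whose Agmon distance to the well set is at least `S`. -/
noncomputable def farSet (A : Matrix (Fin N) (Fin N) ℝ) (u : Fin N → ℝ) (E S : ℝ) :
    Finset (Fin N) :=
  Finset.univ.filter fun i => ENNReal.ofReal S ≤ agmonDistToSet A u E i (wellSet A u E)

variable {u : Fin N → ℝ} {E₀ S M : ℝ}

lemma mem_farSet {i : Fin N} : i ∈ farSet A u E₀ S ↔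
    ENNReal.ofReal S ≤ agmonDistToSet A u E₀ i (wellSet A u E₀) := by
  simp [farSet]

lemma mem_wellSet {i : Fin N} : i ∈ wellSet A u E₀ ↔ effV A u i ≤ E₀ := by
  simp [wellSet]

lemma notMem_wellSet_of_mem_farSet (hS : 0 < S) {i : Fin N} (hi : i ∈ farSet A u E₀ S) :
    i ∉ wellSet A u E₀ := by
  intro h
  rw [mem_farSet, agmonDistToSet_of_mem h] at hi
  simp at hi
  linarith

/-- Eigenvectors, with eigenvalue below `E₀ - δ`, of a matrix obtained from `A` by deleting
off-diagonal entries are exponentially small far from the wells. -/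
lemma sum_farSet_le (hA : A.IsSymm) (hZ : IsZMatrix A) {W : ℕ} (hW : 0 < W)
    (hconn : ConnAtMost A W) (hu : ∀ i, 0 < u i) (hS : 0 < S) (hM : ∀ i j, |A i j| ≤ M)
    {B : Matrix (Fin N) (Fin N) ℝ} (hB : B.IsSymm)
    (hBA : ∀ i j, B i j = A i j ∨ i ≠ j ∧ B i j = 0)
    {δ E : ℝ} (hδ : 0 < δ) (hE : E ≤ E₀ - δ) {φ : Fin N → ℝ} (hφ : B *ᵥ φ = E • φ)
    (hnorm : φ ⬝ᵥ φ = 1) :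
    ∑ i ∈ farSet A u E₀ S, φ i ^ 2 ≤ W * M / 2 / δ / Real.exp (2 * S / √W) := by
  have hedge : ∀ i j, B i j ≠ 0 → B i j = A i j := fun i j h =>
    (hBA i j).resolve_right fun h' => h h'.2
  have hZB : ∀ i j, i ≠ j → B i j ≤ 0 := fun i j hij => by
    rcases hBA i j with h | h
    · exact h ▸ hZ i j hij
    · exact h.2.le
  have hWB : ∀ i, (Finset.univ.filter fun j => j ≠ i ∧ B i j ≠ 0).card ≤ W := fun i =>
    (Finset.card_le_card (Finset.monotone_filter_right _
      fun j _ h => ⟨h.1, hedge i j h.2 ▸ h.2⟩)).trans (hconn i).1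
  have hMB : ∀ i j, |B i j| ≤ M := fun i j => by
    rcases hBA i j with h | h
    · exact h ▸ hM i j
    · rw [h.2, abs_zero]
      exact (abs_nonneg _).trans (hM i j)
  have hVB : ∀ i, effV A u i ≤ (B *ᵥ u) i / u i := fun i => by
    refine div_le_div_of_nonneg_right ?_ (hu i).le
    simp only [mulVec, dotProduct]
    refine Finset.sum_le_sum fun j _ => ?_
    refine mul_le_mul_of_nonneg_right ?_ (hu j).le
    rcases hBA i j with h | h
    · exact h.ge
    · exact h.2 ▸ hZ i j h.1
  have key := agmon_estimate hB hZB hW hWB hu hMB (K := wellSet A u E₀)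
    (g := agmonWeight A u E₀ S (1 / √W) (wellSet A u E₀)) (v := shiftedV A u E₀) (E₀ := E₀)
    (E := E) (δ := δ) (φ := φ) shiftedV_nonneg
    (fun i hi => by
      have h1 : E₀ < effV A u i := not_le.mp fun h => hi (mem_wellSet.mpr h)
      rw [shiftedV, max_eq_left (by linarith)]
      linarith [hVB i])
    (fun i hi => by simp [agmonWeight, hi])
    (fun i hi j hj hij => by
      have hv : shiftedV A u E₀ i = 0 := max_eq_right (by linarith [mem_wellSet.mp hi])
      have hji : A j i ≠ 0 := by
        rw [hA.apply i j, ← hedge i j hij]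
        exact hij
      simp [agmonWeight, hj, truncatedDist_adjacent hi hji hv])
    (fun i hi j hj _ hij => by
      have hBij := hedge i j hij
      rw [hBij] at hij
      rw [hBij]
      exact agmonWeight_edge hA hW hi hj hij)
    hE hφ
  have hn : ∑ i, φ i ^ 2 = 1 := by
    rw [← hnorm, dotProduct]
    exact Finset.sum_congr rfl fun i _ => sq _
  rw [hn, mul_one] at key
  have hfar : Real.exp (2 * S / √W) * ∑ i ∈ farSet A u E₀ S, φ i ^ 2
      ≤ ∑ i, agmonWeight A u E₀ S (1 / √W) (wellSet A u E₀) i ^ 2 * φ i ^ 2 := by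
    rw [Finset.mul_sum]
    refine le_trans (le_of_eq (Finset.sum_congr rfl fun i hi => ?_))
      (Finset.sum_le_univ_sum_of_nonneg fun i => by positivity)
    rw [agmonWeight, if_neg (notMem_wellSet_of_mem_farSet hS hi),
      truncatedDist_of_le hS.le (mem_farSet.mp hi), ← Real.exp_nat_mul]
    congr 2
    push_cast
    ring
  rw [le_div_iff₀ (Real.exp_pos _), le_div_iff₀ hδ]
  nlinarith [mul_le_mul_of_nonneg_left hfar hδ.le]

/-- Changing off-diagonal entries between points far from the wells perturbs the quadratic form by
at most `M` times the mass far from the wells. -/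
lemma abs_quadratic_form_sub_le (hA : A.IsSymm) (hZ : IsZMatrix A) (hu : ∀ i, 0 < u i)
    (hE₀ : 0 < E₀) (hS : 0 < S) (hM : ∀ i j, |A i j| ≤ M) {B : Matrix (Fin N) (Fin N) ℝ}
    (hBA : ∀ i j, B i j = A i j ∨
      i ≠ j ∧ B i j = 0 ∧ (A i j ≠ 0 → i ∈ farSet A u E₀ S ∧ j ∈ farSet A u E₀ S))
    (x : Fin N → ℝ) :
    |x ⬝ᵥ A *ᵥ x - x ⬝ᵥ B *ᵥ x| ≤ M * ∑ i ∈ farSet A u E₀ S, x i ^ 2 := by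
  set f : Fin N → ℝ := fun i => if i ∈ farSet A u E₀ S then |x i| else 0 with hf
  have hf0 : ∀ i, 0 ≤ f i := fun i => by
    simp only [hf]
    split_ifs <;> positivity
  have hfsq : ∑ i, f i ^ 2 = ∑ i ∈ farSet A u E₀ S, x i ^ 2 := by
    rw [← Finset.sum_filter_add_sum_filter_not Finset.univ (· ∈ farSet A u E₀ S)]
    simp only [Finset.filter_mem_eq_inter, Finset.univ_inter]
    rw [Finset.sum_congr rfl fun i hi => (by simp [hf, hi] : f i ^ 2 = x i ^ 2),
      Finset.sum_eq_zero (s := Finset.univ.filter _)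
        (fun i hi => by simp [hf, (Finset.mem_filter.mp hi).2]), add_zero]
  have hpot : 0 ≤ f ⬝ᵥ A *ᵥ f := by
    refine le_trans (Finset.sum_nonneg fun i _ => ?_) (sum_effective_potential_le hA hZ hu f)
    by_cases hi : i ∈ farSet A u E₀ S
    · have h1 : E₀ < effV A u i :=
        not_le.mp fun h => notMem_wellSet_of_mem_farSet hS hi (mem_wellSet.mpr h)
      exact mul_nonneg (hE₀.trans h1).le (sq_nonneg _)
    · simp [hf, hi]
  have hoff : ∑ i, ∑ j, (if i = j then 0 else -A i j * (f i * f j))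
      = ∑ i, A i i * f i ^ 2 - f ⬝ᵥ A *ᵥ f := by
    rw [dotProduct_mulVec_eq_sum, ← Finset.sum_sub_distrib]
    refine Finset.sum_congr rfl fun i _ => ?_
    have : A i i * f i ^ 2 = ∑ j, if i = j then A i j * (f i * f j) else 0 := by
      simp [sq]
    rw [this, ← Finset.sum_sub_distrib]
    refine Finset.sum_congr rfl fun j _ => ?_
    split_ifs <;> ring
  have hterm : ∀ i j, |A i j * (x i * x j) - B i j * (x i * x j)|
      ≤ if i = j then 0 else -A i j * (f i * f j) := by
    intro i j
    rcases hBA i j with h | ⟨hne, h0, hfar⟩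
    · rw [h, sub_self, abs_zero]
      split_ifs with hij
      · exact le_rfl
      · exact mul_nonneg (neg_nonneg.mpr (hZ i j hij)) (mul_nonneg (hf0 i) (hf0 j))
    · rw [if_neg hne, h0, zero_mul, sub_zero]
      by_cases ha : A i j = 0
      · simp [ha]
      · obtain ⟨hi, hj⟩ := hfar ha
        simp only [hf, if_pos hi, if_pos hj]
        rw [abs_mul, abs_mul, abs_of_nonpos (hZ i j hne)]
  calc |x ⬝ᵥ A *ᵥ x - x ⬝ᵥ B *ᵥ x|
      = |∑ i, ∑ j, (A i j * (x i * x j) - B i j * (x i * x j))| := by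
        simp only [dotProduct_mulVec_eq_sum, Finset.sum_sub_distrib]
    _ ≤ ∑ i, ∑ j, |A i j * (x i * x j) - B i j * (x i * x j)| :=
        (Finset.abs_sum_le_sum_abs _ _).trans
          (Finset.sum_le_sum fun i _ => Finset.abs_sum_le_sum_abs _ _)
    _ ≤ ∑ i, ∑ j, (if i = j then 0 else -A i j * (f i * f j)) :=
        Finset.sum_le_sum fun i _ => Finset.sum_le_sum fun j _ => hterm i j
    _ ≤ ∑ i, A i i * f i ^ 2 := by rw [hoff]; linarith
    _ ≤ M * ∑ i ∈ farSet A u E₀ S, x i ^ 2 := by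
        rw [← hfsq, Finset.mul_sum]
        exact Finset.sum_le_sum fun i _ =>
          mul_le_mul_of_nonneg_right ((le_abs_self _).trans (hM i i)) (sq_nonneg _)

end Decoupling

section Blocks

variable {N m : ℕ} {A : Matrix (Fin N) (Fin N) ℝ} {Ω : Fin m → Finset (Fin N)}
  {b : Fin N → Option (Fin m)}

lemma exists_blockLabel (hΩ : ∀ ℓ ℓ', ℓ ≠ ℓ' → Disjoint (Ω ℓ) (Ω ℓ')) :
    ∃ b : Fin N → Option (Fin m), ∀ i ℓ, b i = some ℓ ↔ i ∈ Ω ℓ := by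
  classical
  refine ⟨fun i => if h : ∃ ℓ, i ∈ Ω ℓ then some h.choose else none, fun i ℓ => ?_⟩
  by_cases h : ∃ ℓ, i ∈ Ω ℓ
  · simp only [dif_pos h, Option.some.injEq]
    constructor
    · rintro rfl
      exact h.choose_spec
    · intro hi
      by_contra hne
      exact Finset.disjoint_left.mp (hΩ _ _ hne) h.choose_spec hi
  · simp only [dif_neg h]
    simpa using fun hi => h ⟨ℓ, hi⟩

/-- The matrix `A` with all entries between different blocks removed. -/
def decoupled (A : Matrix (Fin N) (Fin N) ℝ) (b : Fin N → Option (Fin m)) :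
    Matrix (Fin N) (Fin N) ℝ :=
  Matrix.of fun i j => if b i = b j then A i j else 0

lemma decoupled_isSymm (hA : A.IsSymm) : (decoupled A b).IsSymm := by
  refine Matrix.IsSymm.ext fun i j => ?_
  simp only [decoupled, Matrix.of_apply, hA.apply i j, eq_comm (a := b j)]

lemma sum_eq_sum_subtype {s : Finset (Fin N)} {f : Fin N → ℝ} (hf : ∀ i ∉ s, f i = 0) :
    ∑ i, f i = ∑ i : s, f i := by
  rw [Finset.sum_coe_sort s f]
  exact (Finset.sum_subset (Finset.subset_univ s) fun i _ hi => hf i hi).symm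

/-- Extension by zero of a vector on `s`. -/
def extendZero (s : Finset (Fin N)) (e : s → ℝ) (i : Fin N) : ℝ :=
  if h : i ∈ s then e ⟨i, h⟩ else 0

lemma extendZero_coe {s : Finset (Fin N)} (e : s → ℝ) (i : s) : extendZero s e i = e i := by
  simp [extendZero]

lemma extendZero_of_notMem {s : Finset (Fin N)} (e : s → ℝ) {i : Fin N} (hi : i ∉ s) :
    extendZero s e i = 0 := by
  simp [extendZero, hi]

lemma extendZero_dotProduct {s : Finset (Fin N)} (e : s → ℝ) (x : Fin N → ℝ) :
    extendZero s e ⬝ᵥ x = e ⬝ᵥ fun i : s => x i := by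
  rw [dotProduct, sum_eq_sum_subtype (s := s) fun i hi => by simp [extendZero_of_notMem e hi]]
  simp [extendZero_coe, dotProduct]

lemma decoupled_mulVec_extendZero (hb : ∀ i ℓ, b i = some ℓ ↔ i ∈ Ω ℓ) {ℓ : Fin m}
    {e : Ω ℓ → ℝ} {t : ℝ}
    (he : A.submatrix (fun x : Ω ℓ => (x : Fin N)) (fun x : Ω ℓ => (x : Fin N)) *ᵥ e = t • e) :
    decoupled A b *ᵥ extendZero (Ω ℓ) e = t • extendZero (Ω ℓ) e := by
  ext i
  rw [Pi.smul_apply, mulVec, dotProduct_comm, extendZero_dotProduct, smul_eq_mul]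
  by_cases hi : i ∈ Ω ℓ
  · rw [extendZero, dif_pos hi]
    have h1 := congrFun he ⟨i, hi⟩
    rw [Pi.smul_apply, smul_eq_mul] at h1
    rw [← h1, mulVec, dotProduct_comm]
    congr 1
    ext j
    simp [decoupled, (hb i ℓ).mpr hi, (hb j ℓ).mpr j.2]
  · rw [extendZero_of_notMem e hi, mul_zero]
    simp only [dotProduct]
    refine Finset.sum_eq_zero fun j _ => ?_
    have : b i ≠ some ℓ := fun h => hi ((hb i ℓ).mp h)
    simp [decoupled, (hb j ℓ).mpr j.2, this]

lemma decoupled_quadratic_form (hb : ∀ i ℓ, b i = some ℓ ↔ i ∈ Ω ℓ) (x : Fin N → ℝ) :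
    x ⬝ᵥ decoupled A b *ᵥ x
      = (fun i => if b i = none then x i else 0) ⬝ᵥ A *ᵥ (fun i => if b i = none then x i else 0)
        + ∑ ℓ, (fun i : Ω ℓ => x i) ⬝ᵥ
          A.submatrix (fun x : Ω ℓ => (x : Fin N)) (fun x : Ω ℓ => (x : Fin N)) *ᵥ
            (fun i : Ω ℓ => x i) := by
  have h1 : x ⬝ᵥ decoupled A b *ᵥ x = ∑ o : Option (Fin m),
      (fun i => if b i = o then x i else 0) ⬝ᵥ A *ᵥ (fun i => if b i = o then x i else 0) := by
    simp only [dotProduct_mulVec_eq_sum]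
    symm
    rw [Finset.sum_comm]
    refine Finset.sum_congr rfl fun i _ => ?_
    rw [Finset.sum_comm]
    refine Finset.sum_congr rfl fun j _ => ?_
    rw [Finset.sum_eq_single (b i) (fun o _ ho => by simp [ho.symm]) (by simp)]
    by_cases h : b i = b j
    · simp [decoupled, h]
    · simp [decoupled, h, Ne.symm h]
  rw [h1, Fintype.sum_option]
  congr 1
  refine Finset.sum_congr rfl fun ℓ _ => ?_
  simp only [dotProduct_mulVec_eq_sum, hb]
  rw [sum_eq_sum_subtype (s := Ω ℓ) fun i hi => by simp [hi]]
  refine Finset.sum_congr rfl fun i _ => ?_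
  rw [sum_eq_sum_subtype (s := Ω ℓ) fun j hj => by simp [hj]]
  simp

lemma dotProduct_self_eq_sum_blocks (hb : ∀ i ℓ, b i = some ℓ ↔ i ∈ Ω ℓ) (x : Fin N → ℝ) :
    x ⬝ᵥ x = ∑ i, (if b i = none then x i else 0) ^ 2
      + ∑ ℓ, (fun i : Ω ℓ => x i) ⬝ᵥ (fun i : Ω ℓ => x i) := by
  have h1 : x ⬝ᵥ x = ∑ o : Option (Fin m), ∑ i, (if b i = o then x i else 0) ^ 2 := by
    rw [Finset.sum_comm, dotProduct]
    refine Finset.sum_congr rfl fun i _ => ?_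
    rw [Finset.sum_eq_single (b i) (fun o _ ho => by simp [ho.symm]) (by simp)]
    simp [sq]
  rw [h1, Fintype.sum_option]
  congr 1
  refine Finset.sum_congr rfl fun ℓ _ => ?_
  simp only [hb]
  rw [sum_eq_sum_subtype (s := Ω ℓ) fun i hi => by simp [hi]]
  simp [dotProduct, sq]

/-- A nonzero vector orthogonal to all local eigenvectors with eigenvalue at most `μ` has decoupled
energy above `μ`, provided the effective potential exceeds `μ` off the blocks. -/
lemma lt_decoupled_quadratic_form (hA : A.IsHermitian) (hZ : IsZMatrix A) {u : Fin N → ℝ}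
    (hu : ∀ i, 0 < u i) {μ : ℝ} (hb : ∀ i ℓ, b i = some ℓ ↔ i ∈ Ω ℓ)
    (hV : ∀ i, b i = none → μ < effV A u i) {x : Fin N → ℝ} (hx0 : x ≠ 0)
    (hx : ∀ ℓ (j : Ω ℓ), (hA.submatrix (fun x : Ω ℓ => (x : Fin N))).eigenvalues j ≤ μ →
      ((hA.submatrix (fun x : Ω ℓ => (x : Fin N))).eigenvectorBasis j).ofLp ⬝ᵥ
        (fun i : Ω ℓ => x i) = 0) :
    μ * (x ⬝ᵥ x) < x ⬝ᵥ decoupled A b *ᵥ x := by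
  have hsymm : A.IsSymm := by simpa [Matrix.IsSymm] using hA.eq
  rw [decoupled_quadratic_form hb, dotProduct_self_eq_sum_blocks hb x, mul_add, Finset.mul_sum,
    Finset.mul_sum]
  have hlocal := fun ℓ =>
    (hA.submatrix (fun x : Ω ℓ => (x : Fin N))).le_quadratic_form (hx ℓ)
  have hpot := sum_effective_potential_le hsymm hZ hu (fun i => if b i = none then x i else 0)
  have hnone : ∀ i, μ * (if b i = none then x i else 0) ^ 2
      ≤ (A *ᵥ u) i / u i * (if b i = none then x i else 0) ^ 2 := fun i => by
    split_ifs with hi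
    · exact mul_le_mul_of_nonneg_right (hV i hi).le (sq_nonneg _)
    · simp
  obtain ⟨i, hi⟩ := Function.ne_iff.mp hx0
  rcases hbi : b i with _ | ℓ
  · refine add_lt_add_of_lt_of_le (lt_of_lt_of_le ?_ hpot)
      (Finset.sum_le_sum fun ℓ _ => hlocal ℓ)
    refine Finset.sum_lt_sum (fun i _ => hnone i) ⟨i, Finset.mem_univ _, ?_⟩
    rw [if_pos hbi]
    exact mul_lt_mul_of_pos_right (hV i hbi) (sq_pos_of_ne_zero hi)
  · refine add_lt_add_of_le_of_lt ((Finset.sum_le_sum fun i _ => hnone i).trans hpot)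
      (Finset.sum_lt_sum (fun ℓ _ => hlocal ℓ) ⟨ℓ, Finset.mem_univ _, ?_⟩)
    refine (hA.submatrix (fun x : Ω ℓ => (x : Fin N))).lt_quadratic_form (hx ℓ) fun h => hi ?_
    exact congrFun h ⟨i, (hb i ℓ).mp hbi⟩

/-- Under the Separation Hypothesis, nonzero entries between different blocks only join points
whose distance to the wells is at least `S`. -/
lemma mem_farSet_of_block_ne {u : Fin N → ℝ} {E₀ S : ℝ} {Kp : Fin m → Finset (Fin N)}
    (hsep : SeparationHypothesis A u E₀ S Kp Ω) (hb : ∀ i ℓ, b i = some ℓ ↔ i ∈ Ω ℓ)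
    {i j : Fin N} (hij : b i ≠ b j) (ha : A i j ≠ 0) : i ∈ farSet A u E₀ S := by
  obtain ⟨-, -, hK, -, -, hout, hbdry⟩ := hsep
  rw [mem_farSet]
  refine le_iInf₂ fun k hk => ?_
  rw [← hK] at hk
  obtain ⟨ℓ, -, hkℓ⟩ := Finset.mem_biUnion.mp hk
  refine le_trans ?_ (iInf₂_le (f := fun j _ => agmonDist A u E₀ i j) k hkℓ)
  by_cases hi : i ∈ Ω ℓ
  · refine hbdry ℓ i hi ⟨j, fun hj => hij ?_, ha⟩
    rw [(hb i ℓ).mpr hi, (hb j ℓ).mpr hj]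
  · exact hout ℓ i hi

lemma effV_gt_of_block_none {u : Fin N → ℝ} {E₀ S : ℝ} {Kp : Fin m → Finset (Fin N)}
    (hsep : SeparationHypothesis A u E₀ S Kp Ω) (hb : ∀ i ℓ, b i = some ℓ ↔ i ∈ Ω ℓ)
    {i : Fin N} (hi : b i = none) : E₀ < effV A u i := by
  obtain ⟨-, -, hK, hsub, -, -, -⟩ := hsep
  by_contra! h
  have hk := mem_wellSet.mpr h
  rw [← hK] at hk
  obtain ⟨ℓ, -, hiℓ⟩ := Finset.mem_biUnion.mp hk
  have := (hb i ℓ).mpr (hsub ℓ hiℓ)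
  simp [hi] at this

end Blocks

section Counting

lemma coupling_le_gap {W n Nbar : ℕ} (hW : 1 ≤ W) (hn : n ≤ Nbar) {δ M X : ℝ} (hδ : 0 < δ)
    (hX : 0 < X) (h : (W : ℝ) ^ 2 / δ ^ 3 * M ^ 3 * Nbar < X) :
    M ≤ δ ∨ M * (n * (W * M / 2 / δ / X)) ≤ δ := by
  rcases le_or_gt M δ with hM | hM
  · exact Or.inl hM
  refine Or.inr ?_
  have hWr : (1 : ℝ) ≤ W := by exact_mod_cast hW
  have hnr : (n : ℝ) ≤ Nbar := by exact_mod_cast hn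
  have hM0 : 0 < M := hδ.trans hM
  have h1 : (W : ℝ) ^ 2 * M ^ 3 * Nbar < X * δ ^ 3 := by
    have e : (W : ℝ) ^ 2 / δ ^ 3 * M ^ 3 * Nbar = (W : ℝ) ^ 2 * M ^ 3 * Nbar / δ ^ 3 := by ring
    rwa [e, div_lt_iff₀ (by positivity)] at h
  have h2 : (W : ℝ) * M ^ 2 * δ * n ≤ (W : ℝ) ^ 2 * M ^ 3 * Nbar := by
    have e1 : (W : ℝ) ≤ W ^ 2 := by nlinarith
    have e2 : M ^ 2 * δ ≤ M ^ 3 := by nlinarith [sq_nonneg M]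
    calc (W : ℝ) * M ^ 2 * δ * n = W * (M ^ 2 * δ) * n := by ring
      _ ≤ _ := by gcongr
  have h3 : (W : ℝ) * M ^ 2 * n ≤ X * δ ^ 2 := by
    refine le_of_mul_le_mul_right ?_ hδ
    nlinarith
  have e : M * (n * (W * M / 2 / δ / X)) = (W : ℝ) * M ^ 2 * n / (2 * δ * X) := by
    field_simp
  rw [e, div_le_iff₀ (by positivity)]
  nlinarith [mul_pos hX (pow_pos hδ 2)]

end Counting

/-- Eigenvalue counting: under the Separation Hypothesis, with counting
functions `N(λ) = #{eigenvalues of A ≤ λ}` and `N₀(μ) = ∑_ℓ #{eigenvalues of A|_{Ω_ℓ} ≤ μ}`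
(with multiplicity), if `μ ≤ Ē` and `(W_c²/δ³)(max|a_{ij}|)³ N̄ < e^{2S/√W_c}` then
`min(N̄, N₀(μ−δ)) ≤ N(μ)` and `min(N̄, N(μ−δ)) ≤ N₀(μ)`. -/
theorem eigenvalue_counting {N : ℕ} (A : Matrix (Fin N) (Fin N) ℝ)
    (hA : A.IsHermitian) (hZ : IsZMatrix A) (Wc : ℕ) (hWc : 2 ≤ Wc) (hconn : ConnAtMost A Wc)
    (u : Fin N → ℝ) (hu : ∀ i, 0 < u i) (Ebar : ℝ) (hEbar : 0 < Ebar)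
    (S : ℝ) (hS : 0 < S) {m : ℕ} (Kp Ω : Fin m → Finset (Fin N))
    (hsep : SeparationHypothesis A u Ebar S Kp Ω)
    (δ : ℝ) (hδ : 0 < δ) (μ : ℝ) (hμ : μ ≤ Ebar) (Nbar : ℕ)
    (hNbar : (Wc : ℝ) ^ 2 / δ ^ 3 * (⨆ i : Fin N, ⨆ j : Fin N, |A i j|) ^ 3 * Nbar
      < Real.exp (2 * S / Real.sqrt Wc)) :
    let cntGlobal : ℝ → ℕ := fun t =>
      (Finset.univ.filter fun j => hA.eigenvalues j ≤ t).card
    let cntLocal : ℝ → ℕ := fun t => ∑ ℓ : Fin m,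
      (Finset.univ.filter fun j : ↥(Ω ℓ) =>
        (hA.submatrix (fun x : ↥(Ω ℓ) => (x : Fin N))).eigenvalues j ≤ t).card
    min Nbar (cntLocal (μ - δ)) ≤ cntGlobal μ ∧
      min Nbar (cntGlobal (μ - δ)) ≤ cntLocal μ := by
  classical
  intro cntGlobal cntLocal
  set M := ⨆ i : Fin N, ⨆ j : Fin N, |A i j|
  have hM : ∀ i j, |A i j| ≤ M := abs_le_iSup_iSup_abs A
  have hM0 : 0 ≤ M := Real.iSup_nonneg fun i => Real.iSup_nonneg fun j => abs_nonneg _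
  have hW : 0 < Wc := by omega
  have hsymm : A.IsSymm := by simpa [Matrix.IsSymm] using hA.eq
  obtain ⟨b, hb⟩ := exists_blockLabel hsep.2.2.2.2.1
  have hdiff : ∀ x : Fin N → ℝ, |x ⬝ᵥ A *ᵥ x - x ⬝ᵥ decoupled A b *ᵥ x|
      ≤ M * ∑ i ∈ farSet A u Ebar S, x i ^ 2 := by
    refine abs_quadratic_form_sub_le hsymm hZ hu hEbar hS hM fun i j => ?_
    by_cases h : b i = b j
    · exact Or.inl (by simp [decoupled, h])
    · refine Or.inr ⟨fun hij => h (by rw [hij]), by simp [decoupled, h], fun ha => ?_⟩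
      exact ⟨mem_farSet_of_block_ne hsep hb h ha,
        mem_farSet_of_block_ne hsep hb (Ne.symm h) ((hsymm.apply i j).trans_ne ha)⟩
  let J : ℝ → Type := fun t => Σ ℓ : Fin m, {j : Ω ℓ //
    (hA.submatrix (fun x : Ω ℓ => (x : Fin N))).eigenvalues j ≤ t}
  have hJ : ∀ t, Fintype.card (J t) = cntLocal t := fun t => by
    simp [J, cntLocal, Fintype.card_sigma, Fintype.card_subtype]
  have hG : ∀ t, Fintype.card {j // hA.eigenvalues j ≤ t} = cntGlobal t := fun t => by
    simp [cntGlobal, Fintype.card_subtype]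
  let e : ∀ t, J t → Fin N → ℝ := fun t p => extendZero (Ω p.1)
    ((hA.submatrix (fun x : Ω p.1 => (x : Fin N))).eigenvectorBasis p.2.1).ofLp
  constructor
  · set n := min Nbar (cntLocal (μ - δ))
    by_contra! hlt
    obtain ⟨F⟩ : Nonempty (Fin n ↪ J (μ - δ)) := Function.Embedding.nonempty_of_card_le (by
      rw [Fintype.card_fin, hJ]
      exact min_le_right _ _)
    have horth : ∀ k l, e (μ - δ) (F k) ⬝ᵥ e (μ - δ) (F l) = if k = l then 1 else 0 := by
      intro k l
      simp only [← F.injective.eq_iff (a := k)]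
      generalize F k = p
      generalize F l = q
      obtain ⟨ℓ, i, hi⟩ := p
      obtain ⟨ℓ', j, hj⟩ := q
      simp only [e]
      rw [extendZero_dotProduct]
      rcases eq_or_ne ℓ ℓ' with rfl | hne
      · simp only [extendZero_coe]
        rw [Matrix.IsHermitian.dotProduct_eigenvectorBasis]
        rcases eq_or_ne i j with rfl | hij
        · rw [if_pos rfl, if_pos rfl]
        · rw [if_neg hij, if_neg]
          intro h
          exact hij (congrArg Subtype.val (eq_of_heq (Sigma.mk.inj h).2))
      · rw [if_neg fun h => hne (congrArg Sigma.fst h), dotProduct]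
        refine Finset.sum_eq_zero fun x _ => ?_
        rw [extendZero_of_notMem _ (Finset.disjoint_left.mp (hsep.2.2.2.2.1 ℓ ℓ' hne) x.2),
          mul_zero]
    have heig : ∀ k, decoupled A b *ᵥ e (μ - δ) (F k)
        = (hA.submatrix (fun x : Ω (F k).1 => (x : Fin N))).eigenvalues (F k).2.1
          • e (μ - δ) (F k) := fun k =>
      decoupled_mulVec_extendZero hb
        ((hA.submatrix (fun x : Ω (F k).1 => (x : Fin N))).mulVec_eigenvectorBasis _)
    obtain ⟨c, hc0, hc⟩ := exists_combination_orthogonal horth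
      (fun j : {j // hA.eigenvalues j ≤ μ} => (hA.eigenvectorBasis j.1).ofLp)
      (by rw [hG, Fintype.card_fin]; exact hlt)
    have hle := quadratic_form_combination_le (A := A) (B := decoupled A b) (μ := μ) (δ := δ) hM0
      (fun x => by linarith [(abs_le.mp (hdiff x)).2]) horth heig (fun k => (F k).2.2)
      (fun k => sum_farSet_le hsymm hZ hW hconn hu hS hM (decoupled_isSymm hsymm) (fun i j => by
        by_cases h : b i = b j
        · exact Or.inl (by simp [decoupled, h])
        · exact Or.inr ⟨fun hij => h (by rw [hij]), by simp [decoupled, h]⟩) hδ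
        ((F k).2.2.trans (by linarith)) (heig k) (by simpa using horth k k))
      (by
        rw [Fintype.card_fin]
        exact coupling_le_gap hW (min_le_left _ _) hδ (Real.exp_pos _) hNbar) c
    exact absurd (hA.lt_quadratic_form (fun j hj => hc ⟨j, hj⟩) hc0) (not_lt.mpr hle)
  · set n := min Nbar (cntGlobal (μ - δ))
    by_contra! hlt
    obtain ⟨F⟩ : Nonempty (Fin n ↪ {j // hA.eigenvalues j ≤ μ - δ}) :=
      Function.Embedding.nonempty_of_card_le (by
        rw [Fintype.card_fin, hG]
        exact min_le_right _ _)
    have horth : ∀ k l, (hA.eigenvectorBasis (F k).1).ofLp ⬝ᵥ (hA.eigenvectorBasis (F l).1).ofLp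
        = if k = l then 1 else 0 := by
      intro k l
      rw [hA.dotProduct_eigenvectorBasis]
      simp only [← Subtype.ext_iff, F.injective.eq_iff]
    have heig := fun k => hA.mulVec_eigenvectorBasis (F k).1
    obtain ⟨c, hc0, hc⟩ := exists_combination_orthogonal horth (e μ)
      (by rw [hJ, Fintype.card_fin]; exact hlt)
    have hle := quadratic_form_combination_le (A := decoupled A b) (B := A) (μ := μ) (δ := δ) hM0
      (fun x => by linarith [(abs_le.mp (hdiff x)).1]) horth heig (fun k => (F k).2)
      (fun k => sum_farSet_le hsymm hZ hW hconn hu hS hM hsymm (fun i j => Or.inl rfl) hδ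
        ((F k).2.trans (by linarith)) (heig k) (by simpa using horth k k))
      (by
        rw [Fintype.card_fin]
        exact coupling_le_gap hW (min_le_left _ _) hδ (Real.exp_pos _) hNbar) c
    refine absurd (lt_decoupled_quadratic_form hA hZ hu hb
      (fun i hi => hμ.trans_lt (effV_gt_of_block_none hsep hb hi)) hc0 fun ℓ j hj => ?_)
      (not_lt.mpr hle)
    rw [← extendZero_dotProduct]
    exact hc ⟨ℓ, j, hj⟩
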